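/- Let C₁ be the following collection of subsets of {1,...,11}: {1,2}, {1,3,4,5}, {1,6,8}, {1,7,11}, {1,9,10}, {2,3,6,7}, {2,4,11}, {2,5,10}, {2,8,9}, {3,8,11}, {3,9}, {3,10}, {4,6,9}, {4,7}, {4,8}, {4,10}, {5,6}, {5,7}, {5,8}, {5,9,11}, {6,10}, {6,11}, {7,8,10}, {7,9}, {10,11}. Then the only permutation τ of {1,...,11} such that the image under τ of every member of C₁ is again a member of C₁ is the identity. -/

import Mathlib

/- The combinatorics `C₁` of the 11-line arrangements of Appendix B.1 (lines indexed
by `Fin 11`, line `Lk` corresponding to `(k-1 : Fin 11)`). -/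
def C₁ : Finset (Finset (Fin 11)) :=
  {{0, 1},
   {0, 2, 3, 4},
   {0, 5, 7},
   {0, 6, 10},
   {0, 8, 9},
   {1, 2, 5, 6},
   {1, 3, 10},
   {1, 4, 9},
   {1, 7, 8},
   {2, 7, 10},
   {2, 8},
   {2, 9},
   {3, 5, 8},
   {3, 6},
   {3, 7},
   {3, 9},
   {4, 5},
   {4, 6},
   {4, 7},
   {4, 8, 10},
   {5, 9},
   {5, 10},
   {6, 7, 9},
   {6, 8},
   {9, 10}}

def nb (x : Fin 11) : Finset (Fin 11) :=
  ![{1}, {0}, {8, 9}, {6, 7, 9}, {5, 6, 7}, {4, 9, 10}, {3, 4, 8}, {3, 4}, {2, 6},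
    {2, 3, 5, 10}, {5, 9}] x

set_option maxRecDepth 100000 in
set_option maxHeartbeats 4000000 in
theorem nb_iff : ∀ x y : Fin 11, y ∈ nb x ↔ (x ≠ y ∧ ({x, y} : Finset (Fin 11)) ∈ C₁) := by
  decide +kernel

/-- The only permutation preserving the combinatorics `C₁` is the identity. -/
theorem statement15 (τ : Equiv.Perm (Fin 11)) (h : ∀ s ∈ C₁, s.image τ ∈ C₁) :
    τ = 1 := by
  have inj : ∀ x y, τ x = τ y → x = y := fun x y e => τ.injective e
  have A : ∀ x y, y ∈ nb x → τ y ∈ nb (τ x) := by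
    intro x y hy
    rw [nb_iff] at hy ⊢
    refine ⟨fun e => hy.1 (inj _ _ e), ?_⟩
    have := h _ hy.2
    simpa [Finset.image_insert] using this
  have D : ∀ x, (nb x).card ≤ (nb (τ x)).card := by
    intro x
    rw [← Finset.card_image_of_injective (nb x) τ.injective]
    apply Finset.card_le_card
    intro z hz
    obtain ⟨y, hy, rfl⟩ := Finset.mem_image.1 hz
    exact A x y hy
  have h9 : τ 9 = 9 :=
    (by decide +kernel : ∀ x, (nb 9).card ≤ (nb x).card → x = 9) _ (D 9)
  have h5 : τ 5 = 5 :=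
    (by decide +kernel : ∀ x y, x ∈ nb 9 → y ∈ nb 9 → y ∈ nb x →
      (nb 5).card ≤ (nb x).card → x = 5) (τ 5) (τ 10)
      (h9 ▸ A 9 5 (by decide)) (h9 ▸ A 9 10 (by decide)) (A 5 10 (by decide)) (D 5)
  have h10 : τ 10 = 10 :=
    (by decide +kernel : ∀ y, y ∈ nb 9 → y ∈ nb 5 → y = 10) (τ 10)
      (h9 ▸ A 9 10 (by decide)) (h5 ▸ A 5 10 (by decide))
  have ne : ∀ x y, x ≠ y → τ x ≠ τ y := fun x y e e' => e (inj x y e')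
  have h4 : τ 4 = 4 :=
    (by decide +kernel : ∀ y, y ∈ nb 5 → y ≠ 9 → y ≠ 10 → y = 4) (τ 4)
      (h5 ▸ A 5 4 (by decide)) (h9 ▸ ne 4 9 (by decide)) (h10 ▸ ne 4 10 (by decide))
  have h3 : τ 3 = 3 :=
    (by decide +kernel : ∀ y, y ∈ nb 9 → y ≠ 5 → (nb 3).card ≤ (nb y).card → y = 3) (τ 3)
      (h9 ▸ A 9 3 (by decide)) (h5 ▸ ne 3 5 (by decide)) (D 3)
  have h2 : τ 2 = 2 :=
    (by decide +kernel : ∀ y, y ∈ nb 9 → y ≠ 5 → y ≠ 3 → y ≠ 10 → y = 2) (τ 2)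
      (h9 ▸ A 9 2 (by decide)) (h5 ▸ ne 2 5 (by decide)) (h3 ▸ ne 2 3 (by decide))
      (h10 ▸ ne 2 10 (by decide))
  have h8 : τ 8 = 8 :=
    (by decide +kernel : ∀ y, y ∈ nb 2 → y ≠ 9 → y = 8) (τ 8)
      (h2 ▸ A 2 8 (by decide)) (h9 ▸ ne 8 9 (by decide))
  have h6 : τ 6 = 6 :=
    (by decide +kernel : ∀ y, y ∈ nb 8 → y ≠ 2 → y = 6) (τ 6)
      (h8 ▸ A 8 6 (by decide)) (h2 ▸ ne 6 2 (by decide))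
  have h7 : τ 7 = 7 :=
    (by decide +kernel : ∀ y, y ∈ nb 3 → y ≠ 9 → y ≠ 6 → y = 7) (τ 7)
      (h3 ▸ A 3 7 (by decide)) (h9 ▸ ne 7 9 (by decide)) (h6 ▸ ne 7 6 (by decide))
  have h0 : τ 0 = 0 := by
    have := h {0, 5, 7} (by decide +kernel)
    simp only [Finset.image_insert, Finset.image_singleton, h5, h7] at this
    exact (by decide +kernel : ∀ y : Fin 11, y ≠ 5 → y ≠ 7 →
      ({y, 5, 7} : Finset (Fin 11)) ∈ C₁ → y = 0) (τ 0)
      (h5 ▸ ne 0 5 (by decide)) (h7 ▸ ne 0 7 (by decide)) this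
  have h1 : τ 1 = 1 :=
    (by decide +kernel : ∀ y, y ∈ nb 0 → y = 1) (τ 1) (h0 ▸ A 0 1 (by decide))
  ext x
  fin_cases x <;> simp [h0, h1, h2, h3, h4, h5, h6, h7, h8, h9, h10]
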